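/- Let s₀ > 3/2. There exists C > 0 such that for all u₁, u₂, u₃ ∈ H^{max(s,s₀)}(𝕋) and s ≥ 0: ‖Λ_s(u₁ H(u₂∂_x u₃)) − u₁u₂ HΛ_s∂_x u₃‖_{L²} ≤ C(‖u₁‖_{H^s}‖u₂‖_{H^{s₀}}‖u₃‖_{H^{s₀}} + ‖u₁‖_{H^{s₀}}‖u₂‖_{H^s}‖u₃‖_{H^{s₀}} + ‖u₁‖_{H^{s₀}}‖u₂‖_{H^{s₀}}‖u₃‖_{H^s}), where Λ_s = D^s or HD^s. -/

import Mathlib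

open MeasureTheory Real Complex AddCircle
open scoped BigOperators ENNReal

noncomputable section

instance : Fact (0 < 2 * Real.pi) := ⟨by positivity⟩

/-- The torus `ℝ/2πℤ`. -/
abbrev Torus := AddCircle (2 * Real.pi)

/-- Fourier coefficient of a real-valued function on the torus
(with respect to the normalized Haar measure). -/
def FC (f : Torus → ℝ) (n : ℤ) : ℂ :=
  fourierCoeff (fun x => (f x : ℂ)) n

/-- Inhomogeneous Sobolev `H^s` norm, via Fourier coefficients:
`‖f‖_{H^s} = ( ∑ ⟨n⟩^{2s} |f̂(n)|² )^{1/2}`. -/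
def HsNorm (s : ℝ) (f : Torus → ℝ) : ℝ :=
  Real.sqrt (∑' n : ℤ, ((1 + (n : ℝ) ^ 2) ^ s) * ‖FC f n‖ ^ 2)

/-- Homogeneous Sobolev norm `‖D^s f‖_{L²} = ( ∑ |n|^{2s} |f̂(n)|² )^{1/2}`,
where `D = 𝓕⁻¹ |ξ| 𝓕`. -/
def DsNorm (s : ℝ) (f : Torus → ℝ) : ℝ :=
  Real.sqrt (∑' n : ℤ, (|(n : ℝ)| ^ (2 * s)) * ‖FC f n‖ ^ 2)

/-- Membership in `H^s(𝕋)` (finiteness of the Sobolev sum). -/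
def MemHs (s : ℝ) (f : Torus → ℝ) : Prop :=
  Summable (fun n : ℤ => ((1 + (n : ℝ) ^ 2) ^ s) * ‖FC f n‖ ^ 2)

/-- `g` is the image of `f` under the Fourier multiplier with symbol `m`. -/
def HasSymbol (m : ℤ → ℂ) (f g : Torus → ℝ) : Prop :=
  ∀ n : ℤ, FC g n = m n * FC f n

/-- Symbol of the Hilbert transform `H`: `-i sgn(n)`. -/
def symH (n : ℤ) : ℂ := -Complex.I * (Int.sign n : ℂ)

/-- Symbol of `D^s = 𝓕⁻¹|ξ|^s𝓕`. -/
def symD (s : ℝ) (n : ℤ) : ℂ := ((|(n : ℝ)| ^ s : ℝ) : ℂ)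

/-- Symbol of `∂ₓ`. -/
def symDx (n : ℤ) : ℂ := Complex.I * (n : ℂ)

/-- Symbol of the smoothed antiderivative `J`: `ψ(ξ)/|ξ|`. -/
def symJ (ψ : ℝ → ℝ) (n : ℤ) : ℂ := ((ψ n / |(n : ℝ)| : ℝ) : ℂ)

/-- `ψ` is a smooth cutoff: `0 ≤ ψ ≤ 1`, `ψ = 1` on `|ξ| ≥ 2`, `ψ = 0` on `|ξ| ≤ 1`. -/
def IsCutoff (ψ : ℝ → ℝ) : Prop :=
  ContDiff ℝ (⊤ : ℕ∞) ψ ∧ (∀ x, 0 ≤ ψ x) ∧ (∀ x, ψ x ≤ 1) ∧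
    (∀ x, 2 ≤ |x| → ψ x = 1) ∧ (∀ x, |x| ≤ 1 → ψ x = 0)

/-- Rapid decay of Fourier coefficients (a model for "sufficiently smooth"). -/
def SmoothFC (f : Torus → ℝ) : Prop :=
  ∀ k : ℕ, Summable (fun n : ℤ => |(n : ℝ)| ^ k * ‖FC f n‖)

/-- `L²` pairing `⟨f, g⟩ = ∫ f g`. -/
def inn (f g : Torus → ℝ) : ℝ := ∫ x : Torus, f x * g x ∂haarAddCircle

/-- Trilinear integral `∫ f g h`. -/
def inn3 (f g h : Torus → ℝ) : ℝ := ∫ x : Torus, f x * g x * h x ∂haarAddCircle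

/-- Quadrilinear integral `∫ f g h k`. -/
def inn4 (f g h k : Torus → ℝ) : ℝ :=
  ∫ x : Torus, f x * g x * h x * k x ∂haarAddCircle


/-- A commutator-type power inequality. -/
lemma abs_rpow_sub_rpow_mul_le {s x y d : ℝ} (hs : 0 ≤ s) (hx : 0 ≤ x) (hy : 0 ≤ y)
    (hxy : |x - y| ≤ d) :
    |x ^ s - y ^ s| * y ≤ 3 ^ s * (2 + 2 * s) * (d ^ s * y + d * y ^ s) := by
  have hd : 0 ≤ d := (abs_nonneg _).trans hxy
  have hds : 0 ≤ d ^ s := by positivity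
  have hys : 0 ≤ y ^ s := by positivity
  have h3 : (0 : ℝ) ≤ 3 ^ s := by positivity
  obtain ⟨h1, h2⟩ := abs_le.mp hxy
  rcases le_or_gt y (2 * d) with h | h
  · have hx3 : x ^ s ≤ 3 ^ s * d ^ s := by
      rw [← Real.mul_rpow (by norm_num) hd]
      exact Real.rpow_le_rpow hx (by linarith) hs
    have hy3 : y ^ s ≤ 3 ^ s * d ^ s := by
      rw [← Real.mul_rpow (by norm_num) hd]
      exact Real.rpow_le_rpow hy (by linarith) hs
    have hxs : 0 ≤ x ^ s := by positivity
    have : |x ^ s - y ^ s| ≤ 3 ^ s * d ^ s := abs_le.mpr ⟨by linarith, by linarith⟩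
    calc |x ^ s - y ^ s| * y ≤ 3 ^ s * d ^ s * y := by gcongr
      _ = 3 ^ s * 1 * (d ^ s * y + 0) := by ring
      _ ≤ _ := by
        gcongr
        · linarith
        · positivity
  · have hy0 : 0 < y := by linarith
    have hder : ∀ z ∈ Set.Icc (y / 2) (3 * y / 2),
        HasDerivWithinAt (fun z : ℝ => z ^ s) (s * z ^ (s - 1)) (Set.Icc (y / 2) (3 * y / 2)) z := by
      intro z hz
      have hz0 : 0 < z := by linarith [hz.1]
      exact (Real.hasDerivAt_rpow_const (Or.inl hz0.ne')).hasDerivWithinAt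
    have hbound : ∀ z ∈ Set.Icc (y / 2) (3 * y / 2),
        ‖s * z ^ (s - 1)‖ ≤ s * (3 ^ s * y ^ s * (2 / y)) := by
      intro z hz
      have hz0 : 0 < z := by linarith [hz.1]
      rw [Real.norm_of_nonneg (by positivity), Real.rpow_sub_one hz0.ne', div_eq_mul_inv,
        ← Real.mul_rpow (by norm_num) hy]
      gcongr
      · linarith [hz.2]
      · rw [inv_le_comm₀ hz0 (by positivity), inv_div]
        exact hz.1
    have hmv := (convex_Icc (y / 2) (3 * y / 2)).norm_image_sub_le_of_norm_hasDerivWithin_le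
      hder hbound (x := y) (y := x) ⟨by linarith, by linarith⟩ ⟨by linarith, by linarith⟩
    rw [Real.norm_eq_abs, Real.norm_eq_abs] at hmv
    calc |x ^ s - y ^ s| * y ≤ s * (3 ^ s * y ^ s * (2 / y)) * d * y := by
          gcongr
          exact hmv.trans (by gcongr)
      _ = 3 ^ s * (2 * s) * (0 + d * y ^ s) := by field_simp; ring
      _ ≤ _ := by
        gcongr
        · linarith
        · positivity

lemma add_rpow_le_two_rpow_mul {s a b : ℝ} (hs : 0 ≤ s) (ha : 0 ≤ a) (hb : 0 ≤ b) :
    (a + b) ^ s ≤ 2 ^ s * (a ^ s + b ^ s) := by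
  have has : 0 ≤ a ^ s := by positivity
  have hbs : 0 ≤ b ^ s := by positivity
  rcases le_total a b with h | h
  · calc (a + b) ^ s ≤ (2 * b) ^ s := Real.rpow_le_rpow (by positivity) (by linarith) hs
      _ = 2 ^ s * (0 + b ^ s) := by rw [Real.mul_rpow (by norm_num) hb, zero_add]
      _ ≤ _ := by gcongr
  · calc (a + b) ^ s ≤ (2 * a) ^ s := Real.rpow_le_rpow (by positivity) (by linarith) hs
      _ = 2 ^ s * (a ^ s + 0) := by rw [Real.mul_rpow (by norm_num) ha, add_zero]
      _ ≤ _ := by gcongr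

lemma norm_symH_le_one (n : ℤ) : ‖symH n‖ ≤ 1 := by
  rcases lt_trichotomy n 0 with h | h | h
  · simp [symH, Int.sign_eq_neg_one_of_neg h]
  · simp [symH, h]
  · simp [symH, Int.sign_eq_one_of_pos h]

lemma norm_symD (s : ℝ) (n : ℤ) : ‖symD s n‖ = |(n : ℝ)| ^ s := by
  rw [symD, Complex.norm_real, Real.norm_of_nonneg (by positivity)]

/-- The symbol of the commutator, bounded through the frequency increment `d`. -/
lemma norm_commutator_symbol_le {s : ℝ} (hs : 0 ≤ s) {lam : ℤ → ℂ}
    (hlam : lam = symD s ∨ lam = fun n => symH n * symD s n) (n m k : ℤ) {d : ℝ}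
    (hd : d = |((n - m : ℤ) : ℝ)| + |((m - k : ℤ) : ℝ)|) :
    ‖lam n * symH m - symH k * lam k‖ * |(k : ℝ)| ≤
      3 ^ s * (2 + 2 * s) * (d ^ s * |(k : ℝ)| + d * |(k : ℝ)| ^ s) := by
  have hd0 : 0 ≤ d := by rw [hd]; positivity
  have hnk : |(n : ℝ) - k| ≤ d := by
    rw [hd]; push_cast
    exact abs_sub_le _ _ _
  have habs : |(|(n : ℝ)| - |(k : ℝ)|)| ≤ d := (abs_abs_sub_abs_le _ _).trans hnk
  have hlam_le : ∀ j, ‖lam j‖ ≤ |(j : ℝ)| ^ s := by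
    intro j
    rcases hlam with rfl | rfl
    · exact (norm_symD s j).le
    · rw [norm_mul, norm_symD]
      exact mul_le_of_le_one_left (by positivity) (norm_symH_le_one j)
  rcases le_or_gt |(k : ℝ)| d with h | h
  · have hn : |(n : ℝ)| ≤ 3 * d := by linarith [(abs_le.mp habs).2]
    have h3 : ∀ x : ℝ, |x| ≤ 3 * d → |x| ^ s ≤ 3 ^ s * d ^ s := by
      intro x hx
      rw [← Real.mul_rpow (by norm_num) hd0]
      exact Real.rpow_le_rpow (abs_nonneg _) hx hs
    have h1 : ‖lam n * symH m‖ ≤ 3 ^ s * d ^ s := by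
      rw [norm_mul]
      exact (mul_le_of_le_one_right (norm_nonneg _) (norm_symH_le_one m)).trans
        ((hlam_le n).trans (h3 _ hn))
    have h2 : ‖symH k * lam k‖ ≤ 3 ^ s * d ^ s := by
      rw [norm_mul]
      exact (mul_le_of_le_one_left (norm_nonneg _) (norm_symH_le_one k)).trans
        ((hlam_le k).trans (h3 _ (by linarith)))
    calc ‖lam n * symH m - symH k * lam k‖ * |(k : ℝ)|
        ≤ (3 ^ s * d ^ s + 3 ^ s * d ^ s) * |(k : ℝ)| := by
          gcongr
          exact (norm_sub_le _ _).trans (add_le_add h1 h2)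
      _ = 3 ^ s * 2 * (d ^ s * |(k : ℝ)| + 0) := by ring
      _ ≤ _ := by
        gcongr
        · linarith
        · positivity
  · have hmk : |(m : ℝ) - k| ≤ d := by
      rw [hd]; push_cast
      linarith [abs_nonneg ((n : ℝ) - m)]
    have hsign : n.sign = k.sign ∧ m.sign = k.sign ∧ (k.sign = 1 ∨ k.sign = -1) := by
      have e1 := abs_le.mp hnk
      have e2 := abs_le.mp hmk
      rcases lt_or_ge 0 k with hk | hk
      · have hkr : (0 : ℝ) < k := by exact_mod_cast hk
        rw [abs_of_pos hkr] at h
        have hn : 0 < n := by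
          have : (0 : ℝ) < n := by linarith
          exact_mod_cast this
        have hm : 0 < m := by
          have : (0 : ℝ) < m := by linarith
          exact_mod_cast this
        simp [Int.sign_eq_one_of_pos hk, Int.sign_eq_one_of_pos hn, Int.sign_eq_one_of_pos hm]
      · have hkr : (k : ℝ) ≤ 0 := by exact_mod_cast hk
        rw [abs_of_nonpos hkr] at h
        have hk' : k < 0 := by
          have : (k : ℝ) < 0 := by linarith
          exact_mod_cast this
        have hn : n < 0 := by
          have : (n : ℝ) < 0 := by linarith
          exact_mod_cast this
        have hm : m < 0 := by
          have : (m : ℝ) < 0 := by linarith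
          exact_mod_cast this
        simp [Int.sign_eq_neg_one_of_neg hk', Int.sign_eq_neg_one_of_neg hn,
          Int.sign_eq_neg_one_of_neg hm]
    obtain ⟨hsn, hsm, hsk⟩ := hsign
    have hHn : symH n = symH k := by rw [symH, symH, hsn]
    have hHm : symH m = symH k := by rw [symH, symH, hsm]
    have hH1 : ‖symH k‖ = 1 := by
      rcases hsk with h | h <;> simp [symH, h]
    have key : ‖lam n * symH m - symH k * lam k‖ = |(|(n : ℝ)|) ^ s - |(k : ℝ)| ^ s| := by
      have hD : ‖symD s n - symD s k‖ = |(|(n : ℝ)|) ^ s - |(k : ℝ)| ^ s| := by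
        rw [symD, symD, ← Complex.ofReal_sub, Complex.norm_real, Real.norm_eq_abs]
      rcases hlam with rfl | rfl
      · rw [hHm, mul_comm, ← mul_sub, norm_mul, hH1, one_mul, hD]
      · have : symH n * symD s n * symH m - symH k * (symH k * symD s k)
            = symH k * symH k * (symD s n - symD s k) := by rw [hHn, hHm]; ring
        simp only [this, norm_mul, hH1, one_mul, hD]
    rw [key]
    exact abs_rpow_sub_rpow_mul_le hs (abs_nonneg _) (abs_nonneg _) habs

/-- The weight `⟨n⟩^r = (1 + n²)^{r/2}`. -/
def bracketPow (r : ℝ) (n : ℤ) : ℝ := (1 + (n : ℝ) ^ 2) ^ (r / 2)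

lemma bracketPow_nonneg (r : ℝ) (n : ℤ) : 0 ≤ bracketPow r n := by
  unfold bracketPow; positivity

lemma bracketPow_mono {r t : ℝ} (h : r ≤ t) (n : ℤ) : bracketPow r n ≤ bracketPow t n :=
  Real.rpow_le_rpow_of_exponent_le (by nlinarith [sq_nonneg (n : ℝ)]) (by linarith)

lemma bracketPow_sq (r : ℝ) (n : ℤ) : bracketPow r n ^ 2 = (1 + (n : ℝ) ^ 2) ^ r := by
  rw [bracketPow, ← Real.rpow_mul_natCast (by positivity)]
  congr 1
  push_cast
  ring

lemma bracketPow_zero (n : ℤ) : bracketPow 0 n = 1 := by simp [bracketPow]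

lemma bracketPow_mul (r t : ℝ) (n : ℤ) :
    bracketPow r n * bracketPow t n = bracketPow (r + t) n := by
  rw [bracketPow, bracketPow, bracketPow, ← Real.rpow_add (by positivity), add_div]

lemma abs_rpow_le_bracketPow {r : ℝ} (hr : 0 ≤ r) (n : ℤ) : |(n : ℝ)| ^ r ≤ bracketPow r n := by
  have h : bracketPow r n = (Real.sqrt (1 + (n : ℝ) ^ 2)) ^ r := by
    rw [bracketPow, Real.sqrt_eq_rpow, ← Real.rpow_mul (by positivity)]
    congr 1
    ring
  rw [h]
  exact Real.rpow_le_rpow (abs_nonneg _) (Real.abs_le_sqrt (by linarith)) hr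

lemma abs_le_bracketPow_one (n : ℤ) : |(n : ℝ)| ≤ bracketPow 1 n := by
  simpa using abs_rpow_le_bracketPow zero_le_one n

/-- The commutator symbol is bounded by weights on which `Λ_s` falls on only one factor. -/
lemma norm_commutator_symbol_mul_symDx_le {s : ℝ} (hs : 0 ≤ s) {lam : ℤ → ℂ}
    (hlam : lam = symD s ∨ lam = fun n => symH n * symD s n) (n m k : ℤ) :
    ‖(lam n * symH m - symH k * lam k) * symDx k‖ ≤
      6 ^ s * (2 + 2 * s) *
        (bracketPow s (n - m) * bracketPow 1 k + bracketPow s (m - k) * bracketPow 1 k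
          + bracketPow 1 (n - m) * bracketPow s k + bracketPow 1 (m - k) * bracketPow s k) := by
  have hk : ‖symDx k‖ = |(k : ℝ)| := by simp [symDx]
  rw [norm_mul, hk]
  refine (norm_commutator_symbol_le hs hlam n m k rfl).trans ?_
  set a := |((n - m : ℤ) : ℝ)| with ha
  set b := |((m - k : ℤ) : ℝ)| with hb
  have ha0 : 0 ≤ a := abs_nonneg _
  have hb0 : 0 ≤ b := abs_nonneg _
  have h2 : (1 : ℝ) ≤ 2 ^ s := Real.one_le_rpow (by norm_num) hs
  have h6 : (6 : ℝ) ^ s = 3 ^ s * 2 ^ s := by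
    rw [← Real.mul_rpow (by norm_num) (by norm_num)]; norm_num
  have hpa := abs_rpow_le_bracketPow hs (n - m)
  have hpb := abs_rpow_le_bracketPow hs (m - k)
  have hpk := abs_rpow_le_bracketPow hs k
  have hqa := abs_le_bracketPow_one (n - m)
  have hqb := abs_le_bracketPow_one (m - k)
  have hqk := abs_le_bracketPow_one k
  have B := bracketPow_nonneg
  calc 3 ^ s * (2 + 2 * s) * ((a + b) ^ s * |(k : ℝ)| + (a + b) * |(k : ℝ)| ^ s)
      ≤ 3 ^ s * (2 + 2 * s) * (2 ^ s * (a ^ s + b ^ s) * |(k : ℝ)|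
          + 2 ^ s * (a + b) * |(k : ℝ)| ^ s) := by
        gcongr
        · exact add_rpow_le_two_rpow_mul hs ha0 hb0
        · exact le_mul_of_one_le_left (by positivity) h2
    _ = 6 ^ s * (2 + 2 * s) * ((a ^ s + b ^ s) * |(k : ℝ)| + (a + b) * |(k : ℝ)| ^ s) := by
        rw [h6]; ring
    _ ≤ 6 ^ s * (2 + 2 * s) * ((bracketPow s (n - m) + bracketPow s (m - k)) * bracketPow 1 k
          + (bracketPow 1 (n - m) + bracketPow 1 (m - k)) * bracketPow s k) := by
        have := B s (n - m)
        have := B s (m - k)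
        have := B 1 (n - m)
        have := B 1 (m - k)
        gcongr
    _ = _ := by ring

lemma ennreal_tsum_mul_sq_le {ι : Type*} (f g : ι → ℝ≥0∞) :
    (∑' i, f i * g i) ^ 2 ≤ (∑' i, f i ^ 2) * ∑' i, g i ^ 2 := by
  let _ : MeasurableSpace ι := ⊤
  have h := ENNReal.lintegral_mul_le_Lp_mul_Lq (Measure.count : Measure ι)
    (Real.HolderConjugate.two_two) (f := f) (g := g)
    (measurable_from_top.aemeasurable) (measurable_from_top.aemeasurable)
  simp only [lintegral_count, Pi.mul_apply] at h
  calc _ ≤ _ := pow_le_pow_left' h 2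
    _ = _ := by
      rw [mul_pow, ← ENNReal.rpow_mul_natCast, ← ENNReal.rpow_mul_natCast]
      norm_num

lemma ennreal_tsum_mul_sq_le_tsum_mul {ι : Type*} (f g : ι → ℝ≥0∞) :
    (∑' i, f i * g i) ^ 2 ≤ (∑' i, f i) * ∑' i, f i * g i ^ 2 := by
  have hf : ∀ i, f i ^ (1 / 2 : ℝ) * f i ^ (1 / 2 : ℝ) = f i := by
    intro i
    rw [← ENNReal.rpow_add_of_nonneg _ _ (by norm_num) (by norm_num)]
    norm_num
  have h := ennreal_tsum_mul_sq_le (fun i => f i ^ (1 / 2 : ℝ))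
    (fun i => f i ^ (1 / 2 : ℝ) * g i)
  simpa only [← mul_assoc, hf, mul_pow, sq (_ ^ (1 / 2 : ℝ))] using h

/-- Discrete convolution on `ℤ`. -/
def zconv (f g : ℤ → ℝ≥0∞) (n : ℤ) : ℝ≥0∞ := ∑' m : ℤ, f (n - m) * g m

lemma zconv_comm (f g : ℤ → ℝ≥0∞) : zconv f g = zconv g f := by
  funext n
  rw [zconv, ← (Equiv.subLeft n).tsum_eq]
  simp [zconv, mul_comm]

lemma tsum_zconv (f g : ℤ → ℝ≥0∞) : ∑' n, zconv f g n = (∑' n, f n) * ∑' n, g n := by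
  simp only [zconv]
  rw [ENNReal.tsum_comm, ← ENNReal.tsum_mul_left]
  congr 1
  funext m
  rw [ENNReal.tsum_mul_right]
  congr 1
  exact (Equiv.subRight m).tsum_eq f

/-- Young inequality `ℓ² * ℓ¹ ⊆ ℓ²`. -/
lemma tsum_zconv_sq_le (f g : ℤ → ℝ≥0∞) :
    ∑' n, zconv f g n ^ 2 ≤ (∑' n, f n ^ 2) * (∑' n, g n) ^ 2 := by
  calc ∑' n, zconv f g n ^ 2
      ≤ ∑' n, (∑' m, g m) * zconv (fun j => f j ^ 2) g n := by
        refine ENNReal.tsum_le_tsum fun n => ?_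
        have h := ennreal_tsum_mul_sq_le_tsum_mul g (fun m => f (n - m))
        simpa only [zconv, mul_comm] using h
    _ = _ := by rw [ENNReal.tsum_mul_left, tsum_zconv]; ring

lemma tsum_zconv_sq_le' (f g : ℤ → ℝ≥0∞) :
    ∑' n, zconv f g n ^ 2 ≤ (∑' n, f n) ^ 2 * ∑' n, g n ^ 2 := by
  rw [zconv_comm, mul_comm]
  exact tsum_zconv_sq_le g f

/-- The weighted Fourier coefficients `⟨n⟩^r |f̂(n)|`. -/
def wFC (r : ℝ) (f : Torus → ℝ) (n : ℤ) : ℝ≥0∞ := ENNReal.ofReal (bracketPow r n * ‖FC f n‖)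

lemma wFC_eq (r : ℝ) (f : Torus → ℝ) (n : ℤ) :
    wFC r f n = ENNReal.ofReal (bracketPow r n) * ‖FC f n‖ₑ := by
  rw [wFC, ENNReal.ofReal_mul (bracketPow_nonneg r n), ofReal_norm]

lemma wFC_sq (r : ℝ) (f : Torus → ℝ) (n : ℤ) :
    wFC r f n ^ 2 = ENNReal.ofReal ((1 + (n : ℝ) ^ 2) ^ r * ‖FC f n‖ ^ 2) := by
  rw [wFC, ← ENNReal.ofReal_pow (mul_nonneg (bracketPow_nonneg r n) (norm_nonneg _)), mul_pow,
    bracketPow_sq]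

lemma HsNorm_nonneg (r : ℝ) (f : Torus → ℝ) : 0 ≤ HsNorm r f := Real.sqrt_nonneg _

lemma HsNorm_sq (r : ℝ) (f : Torus → ℝ) :
    HsNorm r f ^ 2 = ∑' n : ℤ, (1 + (n : ℝ) ^ 2) ^ r * ‖FC f n‖ ^ 2 :=
  Real.sq_sqrt (tsum_nonneg fun _ => by positivity)

lemma tsum_wFC_sq {r : ℝ} {f : Torus → ℝ} (h : MemHs r f) :
    ∑' n, wFC r f n ^ 2 = ENNReal.ofReal (HsNorm r f) ^ 2 := by
  rw [← ENNReal.ofReal_pow (HsNorm_nonneg r f), HsNorm_sq,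
    ENNReal.ofReal_tsum_of_nonneg (fun _ => by positivity) h]
  simp only [wFC_sq]

lemma HsNorm_le_of_tsum_wFC_sq_le {r c : ℝ} {f : Torus → ℝ} (hc : 0 ≤ c)
    (h : ∑' n, wFC r f n ^ 2 ≤ ENNReal.ofReal c ^ 2) : HsNorm r f ≤ c := by
  refine abs_le_of_sq_le_sq' ?_ hc |>.2
  have h1 : HsNorm r f ^ 2 = (∑' n, wFC r f n ^ 2).toReal := by
    rw [HsNorm_sq, ENNReal.tsum_toReal_eq (by simp [wFC_sq])]
    congr 1
    funext n
    rw [wFC_sq, ENNReal.toReal_ofReal (by positivity)]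
  rw [h1]
  refine ENNReal.toReal_le_of_le_ofReal (by positivity) ?_
  rwa [ENNReal.ofReal_pow hc]

lemma MemHs.mono {r t : ℝ} {f : Torus → ℝ} (h : MemHs t f) (hrt : r ≤ t) : MemHs r f := by
  refine Summable.of_nonneg_of_le (fun _ => by positivity) (fun n => ?_) h
  gcongr
  nlinarith [sq_nonneg (n : ℝ)]

/-- `∑ ⟨n⟩^{2(1-s₀)}` as an extended nonnegative real. -/
def bracketSum (s₀ : ℝ) : ℝ≥0∞ := ∑' n : ℤ, ENNReal.ofReal ((1 + (n : ℝ) ^ 2) ^ (1 - s₀))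

lemma bracketSum_ne_top {s₀ : ℝ} (hs₀ : 3 / 2 < s₀) : bracketSum s₀ ≠ ⊤ := by
  have hsum : Summable fun n : ℤ => (1 + (n : ℝ) ^ 2) ^ (1 - s₀) := by
    refine Summable.of_norm_bounded_eventually
      (Real.summable_abs_int_rpow (b := 2 * (s₀ - 1)) (by linarith)) ?_
    refine (Set.finite_singleton (0 : ℤ)).subset fun n hn => ?_
    by_contra h0
    refine hn ?_
    have hn0 : (0 : ℝ) < |(n : ℝ)| := by
      rw [abs_pos]; exact_mod_cast h0
    rw [Set.mem_ofPred_eq, Real.norm_of_nonneg (by positivity),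
      show -(2 * (s₀ - 1)) = ((2 : ℕ) : ℝ) * (1 - s₀) by push_cast; ring,
      Real.rpow_natCast_mul hn0.le, sq_abs]
    exact Real.rpow_le_rpow_of_nonpos (by rw [← sq_abs]; positivity) (by linarith) (by linarith)
  exact hsum.tsum_ofReal_ne_top

/-- The embedding of `H^{s₀}` into the weighted Wiener algebra. -/
lemma tsum_wFC_sq_le {s₀ r : ℝ} (hr : r ≤ 1) {f : Torus → ℝ} (h : MemHs s₀ f) :
    (∑' n, wFC r f n) ^ 2 ≤ bracketSum s₀ * ENNReal.ofReal (HsNorm s₀ f) ^ 2 := by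
  have hle : ∀ n, wFC r f n ≤ ENNReal.ofReal (bracketPow (1 - s₀) n) * wFC s₀ f n := by
    intro n
    rw [wFC, wFC, ← ENNReal.ofReal_mul (bracketPow_nonneg _ n), ← mul_assoc, bracketPow_mul]
    refine ENNReal.ofReal_le_ofReal ?_
    gcongr
    exact bracketPow_mono (by linarith) n
  calc (∑' n, wFC r f n) ^ 2
      ≤ (∑' n, ENNReal.ofReal (bracketPow (1 - s₀) n) * wFC s₀ f n) ^ 2 :=
        pow_le_pow_left' (ENNReal.tsum_le_tsum hle) 2
    _ ≤ _ := ennreal_tsum_mul_sq_le _ _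
    _ = _ := by
      rw [tsum_wFC_sq h, bracketSum]
      simp only [← ENNReal.ofReal_pow (bracketPow_nonneg _ _), bracketPow_sq]

lemma ennreal_add_sq_le (a b : ℝ≥0∞) : (a + b) ^ 2 ≤ 2 * (a ^ 2 + b ^ 2) := by
  rcases eq_or_ne a ⊤ with rfl | ha
  · simp
  rcases eq_or_ne b ⊤ with rfl | hb
  · simp
  lift a to NNReal using ha
  lift b to NNReal using hb
  have h : (a + b) ^ 2 ≤ 2 * (a ^ 2 + b ^ 2) := add_sq_le
  exact_mod_cast h

lemma ennreal_add_four_sq_le (a b c d : ℝ≥0∞) :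
    (a + b + c + d) ^ 2 ≤ 4 * (a ^ 2 + b ^ 2 + c ^ 2 + d ^ 2) := by
  calc (a + b + c + d) ^ 2 = ((a + b) + (c + d)) ^ 2 := by ring
    _ ≤ 2 * ((a + b) ^ 2 + (c + d) ^ 2) := ennreal_add_sq_le _ _
    _ ≤ 2 * (2 * (a ^ 2 + b ^ 2) + 2 * (c ^ 2 + d ^ 2)) := by
      gcongr <;> exact ennreal_add_sq_le _ _
    _ = _ := by ring

lemma wFC_zconv_wFC_zconv_wFC (r₁ r₂ r₃ : ℝ) (u₁ u₂ u₃ : Torus → ℝ) (n : ℤ) :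
    zconv (wFC r₁ u₁) (zconv (wFC r₂ u₂) (wFC r₃ u₃)) n = ∑' m : ℤ, ∑' k : ℤ,
      ENNReal.ofReal (bracketPow r₁ (n - m) * bracketPow r₂ (m - k) * bracketPow r₃ k)
        * (‖FC u₁ (n - m)‖ₑ * ‖FC u₂ (m - k)‖ₑ * ‖FC u₃ k‖ₑ) := by
  simp only [zconv, ← ENNReal.tsum_mul_left]
  refine tsum_congr fun m => tsum_congr fun k => ?_
  have B := bracketPow_nonneg
  rw [wFC_eq, wFC_eq, wFC_eq, ENNReal.ofReal_mul (mul_nonneg (B _ _) (B _ _)),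
    ENNReal.ofReal_mul (B _ _)]
  ring

/-- Pointwise bound of the Fourier coefficients of the commutator by convolutions. -/
lemma enorm_tsum_commutator_le {s : ℝ} (hs : 0 ≤ s) {lam : ℤ → ℂ}
    (hlam : lam = symD s ∨ lam = fun n => symH n * symD s n) (u₁ u₂ u₃ : Torus → ℝ) (n : ℤ) :
    ‖∑' m : ℤ, ∑' k : ℤ, (lam n * symH m - symH k * lam k) * symDx k
        * FC u₁ (n - m) * FC u₂ (m - k) * FC u₃ k‖ₑ ≤
      ENNReal.ofReal (6 ^ s * (2 + 2 * s)) *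
        (zconv (wFC s u₁) (zconv (wFC 0 u₂) (wFC 1 u₃)) n
          + zconv (wFC 0 u₁) (zconv (wFC s u₂) (wFC 1 u₃)) n
          + zconv (wFC 1 u₁) (zconv (wFC 0 u₂) (wFC s u₃)) n
          + zconv (wFC 0 u₁) (zconv (wFC 1 u₂) (wFC s u₃)) n) := by
  simp only [wFC_zconv_wFC_zconv_wFC, ← ENNReal.tsum_add, ← ENNReal.tsum_mul_left]
  refine enorm_tsum_le_tsum_enorm.trans (ENNReal.tsum_le_tsum fun m => ?_)
  refine enorm_tsum_le_tsum_enorm.trans (ENNReal.tsum_le_tsum fun k => ?_)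
  have B := bracketPow_nonneg
  simp only [bracketPow_zero, one_mul, mul_one]
  rw [← add_mul, ← add_mul, ← add_mul,
    ← ENNReal.ofReal_add (mul_nonneg (B _ _) (B _ _)) (mul_nonneg (B _ _) (B _ _)),
    ← ENNReal.ofReal_add (add_nonneg (mul_nonneg (B _ _) (B _ _)) (mul_nonneg (B _ _) (B _ _)))
      (mul_nonneg (B _ _) (B _ _)),
    ← ENNReal.ofReal_add (add_nonneg (add_nonneg (mul_nonneg (B _ _) (B _ _))
      (mul_nonneg (B _ _) (B _ _))) (mul_nonneg (B _ _) (B _ _))) (mul_nonneg (B _ _) (B _ _)),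
    ← mul_assoc, ← ENNReal.ofReal_mul (by positivity)]
  calc _ = ‖(lam n * symH m - symH k * lam k) * symDx k‖ₑ
        * (‖FC u₁ (n - m)‖ₑ * ‖FC u₂ (m - k)‖ₑ * ‖FC u₃ k‖ₑ) := by
        rw [enorm_mul, enorm_mul, enorm_mul _ (FC u₁ _)]; ring
    _ ≤ _ := by
      gcongr ?_ * _
      rw [← ofReal_norm]
      exact ENNReal.ofReal_le_ofReal (norm_commutator_symbol_mul_symDx_le hs hlam n m k)

lemma tsum_zconv_zconv_sq_le_left (f g h : ℤ → ℝ≥0∞) :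
    ∑' n, zconv f (zconv g h) n ^ 2 ≤ (∑' n, f n ^ 2) * (∑' n, g n) ^ 2 * (∑' n, h n) ^ 2 := by
  refine (tsum_zconv_sq_le _ _).trans_eq ?_
  rw [tsum_zconv, mul_pow, mul_assoc]

lemma tsum_zconv_zconv_sq_le_middle (f g h : ℤ → ℝ≥0∞) :
    ∑' n, zconv f (zconv g h) n ^ 2 ≤ (∑' n, f n) ^ 2 * (∑' n, g n ^ 2) * (∑' n, h n) ^ 2 := by
  refine (tsum_zconv_sq_le' _ _).trans ?_
  rw [mul_assoc]
  gcongr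
  exact tsum_zconv_sq_le g h

lemma tsum_zconv_zconv_sq_le_right (f g h : ℤ → ℝ≥0∞) :
    ∑' n, zconv f (zconv g h) n ^ 2 ≤ (∑' n, f n) ^ 2 * (∑' n, g n) ^ 2 * (∑' n, h n ^ 2) := by
  refine (tsum_zconv_sq_le' _ _).trans ?_
  rw [mul_assoc]
  gcongr
  exact tsum_zconv_sq_le' g h

/-- `‖Λ_s(u₁H(u₂∂ₓu₃)) − u₁u₂HΛ_s∂ₓu₃‖_{L²} ≤ C(...)`, `Λ_s = D^s` or `HD^s`
(the left-hand side described through its Fourier coefficients). -/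
theorem statement14 (s₀ s : ℝ) (hs₀ : 3 / 2 < s₀) (hs : 0 ≤ s) (lam : ℤ → ℂ)
    (hlam : lam = symD s ∨ lam = fun n => symH n * symD s n) :
    ∃ C > (0 : ℝ), ∀ u₁ u₂ u₃ G : Torus → ℝ,
      Continuous u₁ → MemHs (max s s₀) u₁ →
      Continuous u₂ → MemHs (max s s₀) u₂ →
      Continuous u₃ → MemHs (max s s₀) u₃ →
      (∀ n : ℤ, FC G n = ∑' m : ℤ, ∑' k : ℤ,
        (lam n * symH m - symH k * lam k) * symDx k
          * FC u₁ (n - m) * FC u₂ (m - k) * FC u₃ k) →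
      HsNorm 0 G ≤ C * (HsNorm s u₁ * HsNorm s₀ u₂ * HsNorm s₀ u₃
        + HsNorm s₀ u₁ * HsNorm s u₂ * HsNorm s₀ u₃
        + HsNorm s₀ u₁ * HsNorm s₀ u₂ * HsNorm s u₃) := by
  set Z : ℝ := (bracketSum s₀).toReal + 1 with hZ
  have hZ0 : 0 < Z := by positivity
  have hZle : bracketSum s₀ ≤ ENNReal.ofReal Z := by
    rw [← ENNReal.ofReal_toReal (bracketSum_ne_top hs₀)]
    exact ENNReal.ofReal_le_ofReal (by linarith)
  refine ⟨6 ^ s * (2 + 2 * s) * (3 * Z), by positivity, ?_⟩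
  intro u₁ u₂ u₃ G _ h₁ _ h₂ _ h₃ hG
  have N := HsNorm_nonneg
  have l2 : ∀ {u : Torus → ℝ}, MemHs (max s s₀) u →
      ∑' n, wFC s u n ^ 2 ≤ ENNReal.ofReal (HsNorm s u) ^ 2 :=
    fun h => (tsum_wFC_sq (h.mono (le_max_left _ _))).le
  have l1 : ∀ {r : ℝ} {u : Torus → ℝ}, r ≤ 1 → MemHs (max s s₀) u →
      (∑' n, wFC r u n) ^ 2 ≤ ENNReal.ofReal Z * ENNReal.ofReal (HsNorm s₀ u) ^ 2 :=
    fun hr h => (tsum_wFC_sq_le hr (h.mono (le_max_right _ _))).trans (by gcongr)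
  set P₁ := HsNorm s u₁ * HsNorm s₀ u₂ * HsNorm s₀ u₃ with hP₁
  set P₂ := HsNorm s₀ u₁ * HsNorm s u₂ * HsNorm s₀ u₃ with hP₂
  set P₃ := HsNorm s₀ u₁ * HsNorm s₀ u₂ * HsNorm s u₃ with hP₃
  have p₁ : 0 ≤ P₁ := mul_nonneg (mul_nonneg (N _ _) (N _ _)) (N _ _)
  have p₂ : 0 ≤ P₂ := mul_nonneg (mul_nonneg (N _ _) (N _ _)) (N _ _)
  have p₃ : 0 ≤ P₃ := mul_nonneg (mul_nonneg (N _ _) (N _ _)) (N _ _)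
  have ofReal_mul₃ : ∀ a b c : ℝ, 0 ≤ a → 0 ≤ b → ENNReal.ofReal (a * b * c)
      = ENNReal.ofReal a * ENNReal.ofReal b * ENNReal.ofReal c := fun a b c ha hb => by
    rw [ENNReal.ofReal_mul (mul_nonneg ha hb), ENNReal.ofReal_mul ha]
  have b₁ : ∑' n, zconv (wFC s u₁) (zconv (wFC 0 u₂) (wFC 1 u₃)) n ^ 2
      ≤ ENNReal.ofReal Z ^ 2 * ENNReal.ofReal P₁ ^ 2 := by
    refine (tsum_zconv_zconv_sq_le_left _ _ _).trans
      ((mul_le_mul' (mul_le_mul' (l2 h₁) (l1 zero_le_one h₂)) (l1 le_rfl h₃)).trans_eq ?_)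
    rw [hP₁, ofReal_mul₃ _ _ _ (N _ _) (N _ _)]
    ring
  have b₂ : ∑' n, zconv (wFC 0 u₁) (zconv (wFC s u₂) (wFC 1 u₃)) n ^ 2
      ≤ ENNReal.ofReal Z ^ 2 * ENNReal.ofReal P₂ ^ 2 := by
    refine (tsum_zconv_zconv_sq_le_middle _ _ _).trans
      ((mul_le_mul' (mul_le_mul' (l1 zero_le_one h₁) (l2 h₂)) (l1 le_rfl h₃)).trans_eq ?_)
    rw [hP₂, ofReal_mul₃ _ _ _ (N _ _) (N _ _)]
    ring
  have b₃ : ∀ {r t : ℝ}, r ≤ 1 → t ≤ 1 →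
      ∑' n, zconv (wFC r u₁) (zconv (wFC t u₂) (wFC s u₃)) n ^ 2
        ≤ ENNReal.ofReal Z ^ 2 * ENNReal.ofReal P₃ ^ 2 := by
    intro r t hr ht
    refine (tsum_zconv_zconv_sq_le_right _ _ _).trans
      ((mul_le_mul' (mul_le_mul' (l1 hr h₁) (l1 ht h₂)) (l2 h₃)).trans_eq ?_)
    rw [hP₃, ofReal_mul₃ _ _ _ (N _ _) (N _ _)]
    ring
  set c : ℝ := 6 ^ s * (2 + 2 * s) with hc
  have hc0 : 0 ≤ c := by positivity
  refine HsNorm_le_of_tsum_wFC_sq_le (by positivity) ?_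
  have hpt : ∀ n, ‖FC G n‖ₑ ≤ ENNReal.ofReal c * _ := fun n =>
    (congrArg enorm (hG n)).trans_le (enorm_tsum_commutator_le hs hlam u₁ u₂ u₃ n)
  clear_value c Z P₁ P₂ P₃
  calc ∑' n, wFC 0 G n ^ 2
      ≤ ∑' n, ENNReal.ofReal c ^ 2 *
          (4 * (zconv (wFC s u₁) (zconv (wFC 0 u₂) (wFC 1 u₃)) n ^ 2
          + zconv (wFC 0 u₁) (zconv (wFC s u₂) (wFC 1 u₃)) n ^ 2
          + zconv (wFC 1 u₁) (zconv (wFC 0 u₂) (wFC s u₃)) n ^ 2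
          + zconv (wFC 0 u₁) (zconv (wFC 1 u₂) (wFC s u₃)) n ^ 2)) := by
        refine ENNReal.tsum_le_tsum fun n => ?_
        rw [wFC_eq, bracketPow_zero, ENNReal.ofReal_one, one_mul]
        refine (pow_le_pow_left' (hpt n) 2).trans ?_
        rw [mul_pow]
        gcongr
        exact ennreal_add_four_sq_le _ _ _ _
    _ ≤ ENNReal.ofReal c ^ 2 * (4 * (ENNReal.ofReal Z ^ 2 * ENNReal.ofReal P₁ ^ 2
          + ENNReal.ofReal Z ^ 2 * ENNReal.ofReal P₂ ^ 2
          + ENNReal.ofReal Z ^ 2 * ENNReal.ofReal P₃ ^ 2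
          + ENNReal.ofReal Z ^ 2 * ENNReal.ofReal P₃ ^ 2)) := by
        simp only [ENNReal.tsum_mul_left, ENNReal.tsum_add]
        gcongr
        · exact b₃ le_rfl zero_le_one
        · exact b₃ zero_le_one le_rfl
    _ = ENNReal.ofReal (c ^ 2 * (4 * (Z ^ 2 * P₁ ^ 2 + Z ^ 2 * P₂ ^ 2 + Z ^ 2 * P₃ ^ 2
          + Z ^ 2 * P₃ ^ 2))) := by
        rw [ENNReal.ofReal_mul (by positivity), ENNReal.ofReal_mul (by positivity),
          ENNReal.ofReal_add (by positivity) (by positivity),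
          ENNReal.ofReal_add (by positivity) (by positivity),
          ENNReal.ofReal_add (by positivity) (by positivity),
          ENNReal.ofReal_mul (by positivity), ENNReal.ofReal_mul (by positivity),
          ENNReal.ofReal_mul (by positivity), ENNReal.ofReal_pow hc0, ENNReal.ofReal_pow hZ0.le,
          ENNReal.ofReal_pow p₁, ENNReal.ofReal_pow p₂, ENNReal.ofReal_pow p₃]
        simp
    _ ≤ ENNReal.ofReal (c * (3 * Z) * (P₁ + P₂ + P₃)) ^ 2 := by
        rw [← ENNReal.ofReal_pow (by positivity)]
        refine ENNReal.ofReal_le_ofReal ?_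
        have h : 4 * (P₁ ^ 2 + P₂ ^ 2 + P₃ ^ 2 + P₃ ^ 2) ≤ 9 * (P₁ + P₂ + P₃) ^ 2 := by
          nlinarith [mul_nonneg p₁ p₂, mul_nonneg p₁ p₃, mul_nonneg p₂ p₃, sq_nonneg P₁,
            sq_nonneg P₂, sq_nonneg P₃]
        calc c ^ 2 * (4 * (Z ^ 2 * P₁ ^ 2 + Z ^ 2 * P₂ ^ 2 + Z ^ 2 * P₃ ^ 2 + Z ^ 2 * P₃ ^ 2))
            = c ^ 2 * Z ^ 2 * (4 * (P₁ ^ 2 + P₂ ^ 2 + P₃ ^ 2 + P₃ ^ 2)) := by ring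
          _ ≤ c ^ 2 * Z ^ 2 * (9 * (P₁ + P₂ + P₃) ^ 2) := by gcongr
          _ = _ := by ring

end
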